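/- Let s > 1, R ≥ 1 and z₁, z₋₁ ∈ ℂ. Define ã(x) := −Im(z₁\bar{z₋₁}e^{2ix}), 𝔳(x) := 2Re(z₁\bar{z₋₁}e^{2ix}), J₁ := (|z₁|²+|z₋₁|²)/2, I₁ := 2|z₁||z₋₁|(2|z₁||z₋₁| − J₁), 𝔞(x,ξ) := ã(x)·|ξ|^{2s}·η_R(ξ)², and h(x,ξ) := (J₁ + 𝔳(x))·ξ. Then 𝔞 is smooth on ℝ², and the Poisson bracket {𝔞,h} := ∂_ξ𝔞·∂_x h − ∂_x𝔞·∂_ξ h satisfies, for all (x,ξ) ∈ ℝ², {𝔞,h}(x,ξ) = I₁·|ξ|^{2s}·η_R(ξ)² + a₁(x)ψ₁(ξ)² + a₂(x)ψ₂(ξ)², where: a₁, a₂ : ℝ → ℝ are smooth, 2π-periodic and nonnegative, with ∑_{ℓ≤3} sup_x |a_j^{(ℓ)}(x)| ≤ C(|z₁|⁴ + |z₋₁|⁴) for a constant C depending only on s; and ψ₁, ψ₂ : ℝ → ℝ are smooth, vanish on (−∞, R], and satisfy |ψ_j^{(n)}(ξ)| ≤ C_n·max(1,|ξ|)^{s−n}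 for every n ≥ 0, with constants C_n depending only on s and n (in particular independent of R). -/

import Mathlib

noncomputable section

/-- The smooth cut-off `η`: `0` for `y ≤ 1`,
`e^{-1/(y-1)} / (e^{-1/(y-1)} + e^{-1/(2-y)})` for `1 < y < 2`, and `1` for `y ≥ 2`. -/
def etaCut (y : ℝ) : ℝ :=
  if y ≤ 1 then 0
  else if y < 2 then
    Real.exp (-(1 / (y - 1))) / (Real.exp (-(1 / (y - 1))) + Real.exp (-(1 / (2 - y))))
  else 1

theorem etaCut_eq (y : ℝ) : etaCut y = Real.smoothTransition (y - 1) := by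
  unfold etaCut
  split_ifs with h1 h2
  · rw [Real.smoothTransition.zero_of_nonpos (by linarith)]
  · have e1 : ¬ (y - 1 ≤ 0) := by linarith
    have e2 : ¬ (1 - (y - 1) ≤ 0) := by linarith
    have e3 : 1 - (y - 1) = 2 - y := by ring
    simp only [Real.smoothTransition, expNegInvGlue, e1, e2, if_false]
    simp only [e3, one_div]
  · rw [Real.smoothTransition.one_of_one_le (by linarith)]

theorem glue_hasDerivAt (x : ℝ) :
    HasDerivAt expNegInvGlue (x⁻¹ ^ 2 * expNegInvGlue x) x := by
  have := expNegInvGlue.hasDerivAt_polynomial_eval_inv_mul 1 x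
  simpa using this

theorem glue_inv_contDiff : ContDiff ℝ (⊤ : ℕ∞) (fun x : ℝ => x⁻¹ * expNegInvGlue x) := by
  have := expNegInvGlue.contDiff_polynomial_eval_inv_mul (n := ⊤) Polynomial.X
  simpa using this

theorem glue_two_sq (t : ℝ) : expNegInvGlue (2 * t) ^ 2 = expNegInvGlue t := by
  by_cases ht : t ≤ 0
  · rw [expNegInvGlue.zero_of_nonpos ht, expNegInvGlue.zero_of_nonpos (by linarith)]; simp
  · have h2 : ¬ (2 * t ≤ 0) := by linarith
    simp only [expNegInvGlue, ht, h2, if_false]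
    rw [← Real.exp_nat_mul]
    congr 1
    rw [mul_inv]; push_cast; ring

/-- Denominator of the cut-off. -/
def etaDen (y : ℝ) : ℝ := expNegInvGlue (y - 1) + expNegInvGlue (2 - y)

theorem etaDen_pos (y : ℝ) : 0 < etaDen y := by
  have := Real.smoothTransition.pos_denom (y - 1)
  rw [show 1 - (y - 1) = 2 - y by ring] at this
  exact this

theorem etaDen_contDiff : ContDiff ℝ (⊤ : ℕ∞) etaDen := by
  unfold etaDen
  exact (expNegInvGlue.contDiff.comp (contDiff_id.sub contDiff_const)).add
    (expNegInvGlue.contDiff.comp (contDiff_const.sub contDiff_id))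

theorem etaCut_eq_div (y : ℝ) : etaCut y = expNegInvGlue (y - 1) / etaDen y := by
  rw [etaCut_eq, Real.smoothTransition, etaDen, show 1 - (y - 1) = 2 - y by ring]

theorem etaCut_contDiff : ContDiff ℝ (⊤ : ℕ∞) etaCut := by
  have : etaCut = fun y => Real.smoothTransition (y - 1) := funext etaCut_eq
  rw [this]
  exact Real.smoothTransition.contDiff.comp (contDiff_id.sub contDiff_const)

theorem etaCut_hasDerivAt (y : ℝ) : HasDerivAt etaCut
    (((y - 1)⁻¹ ^ 2 + (2 - y)⁻¹ ^ 2) * expNegInvGlue (y - 1) * expNegInvGlue (2 - y)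
      / etaDen y ^ 2) y := by
  have h1 : HasDerivAt (fun y : ℝ => expNegInvGlue (y - 1))
      ((y - 1)⁻¹ ^ 2 * expNegInvGlue (y - 1) * 1) y :=
    HasDerivAt.comp (h₂ := expNegInvGlue) y (glue_hasDerivAt (y - 1)) ((hasDerivAt_id' y).sub_const 1)
  have h2 : HasDerivAt (fun y : ℝ => expNegInvGlue (2 - y))
      ((2 - y)⁻¹ ^ 2 * expNegInvGlue (2 - y) * (-1)) y :=
    HasDerivAt.comp (h₂ := expNegInvGlue) y (glue_hasDerivAt (2 - y)) ((hasDerivAt_id' y).const_sub 2)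
  have h3 := h1.div (h1.add h2) (etaDen_pos y).ne'
  have e : etaCut = (fun y : ℝ => expNegInvGlue (y - 1)) /
      ((fun y : ℝ => expNegInvGlue (y - 1)) + fun y : ℝ => expNegInvGlue (2 - y)) := by
    funext y
    rw [etaCut_eq_div]; rfl
  rw [e]
  refine h3.congr_deriv ?_
  simp only [Pi.add_apply, etaDen]
  congr 1
  ring

/-- The first profile `y^s η(y)`. -/
def Phi1 (s y : ℝ) : ℝ := y ^ s * etaCut y

/-- The second profile, a smooth square root of `y^{2s} y η(y) η'(y)`. -/
def Phi2 (s y : ℝ) : ℝ :=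
  y ^ s * Real.sqrt (y * ((2 - y) ^ 2 + (y - 1) ^ 2) * (etaDen y ^ 3)⁻¹) *
    ((y - 1)⁻¹ * expNegInvGlue (y - 1)) * (2 * ((2 * (2 - y))⁻¹ * expNegInvGlue (2 * (2 - y))))

theorem Phi1_zero (s y : ℝ) (h : y ≤ 1) : Phi1 s y = 0 := by
  simp [Phi1, etaCut, h]

theorem Phi2_zero (s y : ℝ) (h : y ≤ 1) : Phi2 s y = 0 := by
  have : expNegInvGlue (y - 1) = 0 := expNegInvGlue.zero_of_nonpos (by linarith)
  simp [Phi2, this]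

theorem contDiff_of_zero (F : ℝ → ℝ) (h0 : ∀ y ≤ 1, F y = 0)
    (h1 : ∀ y, 0 < y → ContDiffAt ℝ (⊤ : ℕ∞) F y) : ContDiff ℝ (⊤ : ℕ∞) F := by
  rw [contDiff_iff_contDiffAt]
  intro y
  rcases lt_or_ge 0 y with hy | hy
  · exact h1 y hy
  · have : F =ᶠ[nhds y] fun _ => (0 : ℝ) := by
      filter_upwards [Iio_mem_nhds (show y < 1 by linarith)] with t ht
      exact h0 t (le_of_lt ht)
    exact contDiffAt_const.congr_of_eventuallyEq this

theorem Phi1_contDiff (s : ℝ) : ContDiff ℝ (⊤ : ℕ∞) (Phi1 s) := by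
  refine contDiff_of_zero _ (Phi1_zero s) fun y hy => ?_
  exact (Real.contDiffAt_rpow_const_of_ne hy.ne').mul etaCut_contDiff.contDiffAt

theorem Phi2_contDiff (s : ℝ) : ContDiff ℝ (⊤ : ℕ∞) (Phi2 s) := by
  refine contDiff_of_zero _ (Phi2_zero s) fun y hy => ?_
  have hq : 0 < (2 - y) ^ 2 + (y - 1) ^ 2 := by nlinarith [sq_nonneg (2 * y - 3)]
  have hd := etaDen_pos y
  have c1 : ContDiff ℝ (⊤ : ℕ∞) (fun y : ℝ => (etaDen y ^ 3)⁻¹) :=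
    (etaDen_contDiff.pow 3).inv fun x => (pow_pos (etaDen_pos x) 3).ne'
  have c2 : ContDiff ℝ (⊤ : ℕ∞) (fun y : ℝ => y * ((2 - y) ^ 2 + (y - 1) ^ 2)) := by fun_prop
  have c3 : ContDiffAt ℝ (⊤ : ℕ∞)
      (fun y : ℝ => Real.sqrt (y * ((2 - y) ^ 2 + (y - 1) ^ 2) * (etaDen y ^ 3)⁻¹)) y :=
    (c2.mul c1).contDiffAt.sqrt (by positivity)
  have c4 : ContDiff ℝ (⊤ : ℕ∞) (fun y : ℝ => (y - 1)⁻¹ * expNegInvGlue (y - 1)) :=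
    glue_inv_contDiff.comp (contDiff_id.sub contDiff_const)
  have c5 : ContDiff ℝ (⊤ : ℕ∞)
      (fun y : ℝ => (2 * (2 - y))⁻¹ * expNegInvGlue (2 * (2 - y))) :=
    glue_inv_contDiff.comp (contDiff_const.mul (contDiff_const.sub contDiff_id))
  exact (((Real.contDiffAt_rpow_const_of_ne hy.ne').mul c3).mul c4.contDiffAt).mul
    (contDiff_const.mul c5).contDiffAt

theorem Phi_key (s y : ℝ) :
    y * (Phi1 s y * deriv (Phi1 s) y) = s * Phi1 s y ^ 2 + Phi2 s y ^ 2 := by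
  rcases le_or_gt y 1 with h | h
  · rw [Phi1_zero s y h, Phi2_zero s y h]; ring
  have hy : 0 < y := by linarith
  have hd := etaDen_pos y
  have hD : HasDerivAt (Phi1 s) _ y :=
    (Real.hasDerivAt_rpow_const (p := s) (Or.inl hy.ne')).mul (etaCut_hasDerivAt y)
  rw [hD.deriv]
  have hq : 0 < (2 - y) ^ 2 + (y - 1) ^ 2 := by nlinarith [sq_nonneg (2 * y - 3)]
  have hsq : Phi2 s y ^ 2 = (y ^ s) ^ 2 * (y * ((2 - y) ^ 2 + (y - 1) ^ 2) * (etaDen y ^ 3)⁻¹) *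
      ((y - 1)⁻¹ * expNegInvGlue (y - 1)) ^ 2 *
        (((2 - y)⁻¹) ^ 2 * expNegInvGlue (2 - y)) := by
    have hS := Real.sq_sqrt
      (show 0 ≤ y * ((2 - y) ^ 2 + (y - 1) ^ 2) * (etaDen y ^ 3)⁻¹ by positivity)
    rw [Phi2, mul_pow, mul_pow, mul_pow, hS, ← glue_two_sq (2 - y), mul_inv]
    ring
  rw [hsq, Phi1, Real.rpow_sub_one hy.ne', etaCut_eq_div]
  have hx : y - 1 ≠ 0 := by linarith
  by_cases ht : 2 - y = 0
  · rw [ht]; simp; field_simp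
  · field_simp

theorem symbol_bound (s : ℝ) (F : ℝ → ℝ) (c : ℝ) (hF : ContDiff ℝ (⊤ : ℕ∞) F)
    (h0 : ∀ y ≤ 1, F y = 0) (h2 : ∀ y, 2 ≤ y → F y = c * y ^ s) (n : ℕ) :
    ∃ K : ℝ, 0 < K ∧ ∀ y, |iteratedDeriv n F y| ≤ K * |y| ^ (s - n) ∧
      (y < 1 → iteratedDeriv n F y = 0) := by
  have hcont : Continuous (iteratedDeriv n F) :=
    hF.continuous_iteratedDeriv n (by exact_mod_cast le_top)
  have hcont2 : ContinuousOn (fun y : ℝ => |iteratedDeriv n F y| * |y| ^ (-(s - n)))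
      (Set.Icc 1 2) := by
    refine hcont.abs.continuousOn.mul (continuous_abs.continuousOn.rpow_const fun x hx => ?_)
    left
    have : 0 < x := by linarith [hx.1]
    positivity
  obtain ⟨M, hM⟩ := isCompact_Icc.bddAbove_image hcont2
  set P := (descPochhammer ℝ n).eval s with hP
  refine ⟨|M| + |c * P| + 1, by positivity, fun y => ?_⟩
  have hz : y < 1 → iteratedDeriv n F y = 0 := by
    intro hy
    have : F =ᶠ[nhds y] fun _ => (0 : ℝ) := by
      filter_upwards [Iio_mem_nhds hy] with t ht
      exact h0 t (le_of_lt ht)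
    rw [this.iteratedDeriv_eq n]
    simp
  refine ⟨?_, hz⟩
  rcases lt_or_ge y 1 with hy | hy
  · rw [hz hy]; simp; positivity
  have hy0 : 0 < |y| := abs_pos.2 (by linarith)
  have hpp : 0 < |y| ^ (s - n) := Real.rpow_pos_of_pos hy0 _
  rcases le_or_gt y 2 with hy2 | hy2
  · have := hM (Set.mem_image_of_mem _ (Set.mem_Icc.2 ⟨hy, hy2⟩))
    rw [Real.rpow_neg hy0.le, ← div_eq_mul_inv, div_le_iff₀ hpp] at this
    refine this.trans (mul_le_mul_of_nonneg_right ?_ hpp.le)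
    linarith [le_abs_self M, abs_nonneg (c * P)]
  · have : F =ᶠ[nhds y] fun t => c * t ^ s := by
      filter_upwards [Ioi_mem_nhds hy2] with t ht
      exact h2 t (le_of_lt ht)
    rw [this.iteratedDeriv_eq n, iteratedDeriv_const_mul_field, iteratedDeriv_eq_iterate,
      Real.iter_deriv_rpow_const, ← mul_assoc, abs_mul, abs_of_pos (show 0 < y by linarith),
      abs_of_pos (Real.rpow_pos_of_pos (show 0 < y by linarith) _)]
    rw [abs_of_pos (show 0 < y by linarith)] at hpp
    refine mul_le_mul_of_nonneg_right ?_ hpp.le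
    linarith [abs_nonneg M]

theorem scaled_bound (s : ℝ) (F : ℝ → ℝ) (hF : ContDiff ℝ (⊤ : ℕ∞) F) (n : ℕ) (K R : ℝ)
    (hR : 1 ≤ R) (hK0 : 0 < K)
    (hK : ∀ y, |iteratedDeriv n F y| ≤ K * |y| ^ (s - n) ∧
      (y < 1 → iteratedDeriv n F y = 0)) (ξ : ℝ) :
    |iteratedDeriv n (fun t => R ^ s * F (R⁻¹ * t)) ξ| ≤ K * (max 1 |ξ|) ^ (s - (n : ℝ)) := by
  have hR0 : 0 < R := by linarith
  rw [iteratedDeriv_const_mul_field,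
    iteratedDeriv_comp_const_mul (hF.of_le (by exact_mod_cast le_top))]
  rcases lt_or_ge (R⁻¹ * ξ) 1 with h | h
  · simp only [(hK _).2 h]
    simp
    positivity
  · have hξ : R ≤ ξ := by
      rw [inv_mul_eq_div, le_div_iff₀ hR0] at h; linarith
    have hξ0 : 0 < ξ := by linarith
    have hm : max 1 |ξ| = ξ := by
      rw [abs_of_pos hξ0]; exact max_eq_right (by linarith)
    have := (hK (R⁻¹ * ξ)).1
    have hRp := Real.rpow_pos_of_pos hR0 s
    rw [hm, abs_mul, abs_mul, abs_of_pos hRp, abs_of_pos (show 0 < R⁻¹ ^ n by positivity)]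
    rw [abs_of_pos (show 0 < R⁻¹ * ξ by positivity), Real.mul_rpow (by positivity) hξ0.le,
      Real.inv_rpow hR0.le, Real.rpow_sub hR0, Real.rpow_natCast] at this
    calc R ^ s * (R⁻¹ ^ n * |iteratedDeriv n F (R⁻¹ * ξ)|)
        ≤ R ^ s * (R⁻¹ ^ n * (K * ((R ^ s / R ^ n)⁻¹ * ξ ^ (s - n)))) := by gcongr
      _ = K * ξ ^ (s - n) := by
        rw [inv_pow]
        field_simp

theorem iter_chain (f0 f1 f2 f3 : ℝ → ℝ) (h1 : ∀ x, HasDerivAt f0 (f1 x) x)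
    (h2 : ∀ x, HasDerivAt f1 (f2 x) x) (h3 : ∀ x, HasDerivAt f2 (f3 x) x) (x : ℝ) :
    (∑ l ∈ Finset.range 4, |iteratedDeriv l f0 x|) = |f0 x| + |f1 x| + |f2 x| + |f3 x| := by
  have e1 : deriv f0 = f1 := funext fun x => (h1 x).deriv
  have e2 : deriv f1 = f2 := funext fun x => (h2 x).deriv
  have e3 : deriv f2 = f3 := funext fun x => (h3 x).deriv
  simp [Finset.sum_range_succ, iteratedDeriv_succ', e1, e2, e3]

theorem coeff_bound (a v : ℝ → ℝ) (ha : ∀ x, HasDerivAt a (-v x) x)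
    (hv : ∀ x, HasDerivAt v (4 * a x) x) (ρ J K L : ℝ) (hρ : 0 ≤ ρ) (hρJ : ρ ≤ J)
    (hK : 0 ≤ K) (hL : 0 ≤ L)
    (hab : ∀ x, |a x| ≤ ρ) (hvb : ∀ x, |v x| ≤ 2 * ρ) (x : ℝ) :
    (∑ l ∈ Finset.range 4, |iteratedDeriv l (fun x => K * a x ^ 2 + L * (J * (2 * ρ + v x))) x|)
      ≤ (85 * K + 32 * L) * J ^ 2 := by
  rw [iter_chain (fun x => K * a x ^ 2 + L * (J * (2 * ρ + v x)))
    (fun x => K * (-2 * (a x * v x)) + L * (J * (4 * a x)))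
    (fun x => K * (2 * v x ^ 2 - 8 * a x ^ 2) + L * (J * (-4 * v x)))
    (fun x => K * (32 * (a x * v x)) + L * (J * (-16 * a x)))]
  · have hJ : 0 ≤ J := hρ.trans hρJ
    have hA : |a x| ≤ J := (hab x).trans hρJ
    have hV : |v x| ≤ 2 * J := (hvb x).trans (by linarith)
    have hAA : a x ^ 2 ≤ J ^ 2 := sq_le_sq' (by linarith [neg_abs_le (a x)]) ((le_abs_self _).trans hA)
    have hVV : v x ^ 2 ≤ (2 * J) ^ 2 :=
      sq_le_sq' (by linarith [neg_abs_le (v x)]) ((le_abs_self _).trans hV)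
    have hAV : |a x * v x| ≤ J * (2 * J) := by
      rw [abs_mul]; exact mul_le_mul hA hV (abs_nonneg _) hJ
    have gen : ∀ p q P Q : ℝ, |p| ≤ P * J ^ 2 → |q| ≤ Q * J →
        |K * p + L * (J * q)| ≤ K * (P * J ^ 2) + L * (Q * J ^ 2) := by
      intro p q P Q hp hq
      refine (abs_add_le _ _).trans (add_le_add ?_ ?_)
      · rw [abs_mul, abs_of_nonneg hK]; exact mul_le_mul_of_nonneg_left hp hK
      · rw [abs_mul, abs_of_nonneg hL, abs_mul, abs_of_nonneg hJ]
        refine mul_le_mul_of_nonneg_left ?_ hL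
        calc J * |q| ≤ J * (Q * J) := mul_le_mul_of_nonneg_left hq hJ
          _ = Q * J ^ 2 := by ring
    have hA' := abs_le.1 hA
    have hV' := abs_le.1 hV
    have hAV' := abs_le.1 hAV
    have b0 := gen (a x ^ 2) (2 * ρ + v x) 1 4 (by rw [abs_of_nonneg (sq_nonneg _)]; linarith)
      (by rw [abs_le]; constructor <;> linarith)
    have b1 := gen (-2 * (a x * v x)) (4 * a x) 4 4 (by rw [abs_le]; constructor <;> nlinarith)
      (by rw [abs_le]; constructor <;> linarith)
    have b2 := gen (2 * v x ^ 2 - 8 * a x ^ 2) (-4 * v x) 16 8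
      (by rw [abs_le]; constructor <;> nlinarith [sq_nonneg (v x), sq_nonneg (a x)])
      (by rw [abs_le]; constructor <;> linarith)
    have b3 := gen (32 * (a x * v x)) (-16 * a x) 64 16 (by rw [abs_le]; constructor <;> nlinarith)
      (by rw [abs_le]; constructor <;> linarith)
    linarith
  · intro x
    refine HasDerivAt.congr_deriv (f := _) ((((ha x).pow 2).const_mul K).add
      ((((hv x).const_add (2 * ρ)).const_mul J).const_mul L)) ?_
    simp; ring_nf; try simp
  · intro x
    refine HasDerivAt.congr_deriv (f := _) (((((ha x).mul (hv x)).const_mul (-2)).const_mul K).add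
      ((((ha x).const_mul 4).const_mul J).const_mul L)) ?_
    simp; ring
  · intro x
    refine HasDerivAt.congr_deriv (f := _) ((((((hv x).pow 2).const_mul 2).sub (((ha x).pow 2).const_mul 8)).const_mul K).add
      ((((hv x).const_mul (-4)).const_mul J).const_mul L)) ?_
    simp; ring

/-- The escape-function lemma behind the Mourre positive commutator estimate: the
Poisson bracket of the Mourre symbol `𝔞(x,ξ) = ã(x)|ξ|^{2s} η_R(ξ)²` with the transport
symbol `h(x,ξ) = (J₁ + 𝔳(x))ξ` equals `I₁ |ξ|^{2s} η_R(ξ)²` plus a nonnegative sum of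
squares `a₁(x)ψ₁(ξ)² + a₂(x)ψ₂(ξ)²` with quantitative bounds uniform in `R`. -/
theorem poisson_bracket_escape_function (s : ℝ) (hs : 1 < s) :
    ∃ C : ℝ, 0 < C ∧ ∃ Cn : ℕ → ℝ, (∀ n, 0 < Cn n) ∧
      ∀ R : ℝ, 1 ≤ R → ∀ z₁ zm1 : ℂ,
        ∀ atil v : ℝ → ℝ, ∀ J₁ I₁ : ℝ, ∀ A h : ℝ → ℝ → ℝ,
          (∀ x : ℝ, atil x =
            -(z₁ * (starRingEnd ℂ) zm1 * Complex.exp (2 * Complex.I * (x : ℂ))).im) →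
          (∀ x : ℝ, v x =
            2 * (z₁ * (starRingEnd ℂ) zm1 * Complex.exp (2 * Complex.I * (x : ℂ))).re) →
          J₁ = (‖z₁‖ ^ 2 + ‖zm1‖ ^ 2) / 2 →
          I₁ = 2 * ‖z₁‖ * ‖zm1‖ * (2 * ‖z₁‖ * ‖zm1‖ - J₁) →
          (∀ x ξ : ℝ, A x ξ = atil x * |ξ| ^ (2 * s) * (etaCut (ξ / R)) ^ 2) →
          (∀ x ξ : ℝ, h x ξ = (J₁ + v x) * ξ) →
          ContDiff ℝ (⊤ : ℕ∞) (fun p : ℝ × ℝ => A p.1 p.2) ∧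
          ∃ a₁ a₂ ψ₁ ψ₂ : ℝ → ℝ,
            ContDiff ℝ (⊤ : ℕ∞) a₁ ∧ ContDiff ℝ (⊤ : ℕ∞) a₂ ∧
            Function.Periodic a₁ (2 * Real.pi) ∧ Function.Periodic a₂ (2 * Real.pi) ∧
            (∀ x, 0 ≤ a₁ x) ∧ (∀ x, 0 ≤ a₂ x) ∧
            (∀ x : ℝ, (∑ l ∈ Finset.range 4, |iteratedDeriv l a₁ x|) ≤
              C * (‖z₁‖ ^ 4 + ‖zm1‖ ^ 4)) ∧
            (∀ x : ℝ, (∑ l ∈ Finset.range 4, |iteratedDeriv l a₂ x|) ≤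
              C * (‖z₁‖ ^ 4 + ‖zm1‖ ^ 4)) ∧
            ContDiff ℝ (⊤ : ℕ∞) ψ₁ ∧ ContDiff ℝ (⊤ : ℕ∞) ψ₂ ∧
            (∀ ξ : ℝ, ξ ≤ R → ψ₁ ξ = 0) ∧ (∀ ξ : ℝ, ξ ≤ R → ψ₂ ξ = 0) ∧
            (∀ n : ℕ, ∀ ξ : ℝ,
              |iteratedDeriv n ψ₁ ξ| ≤ Cn n * (max 1 |ξ|) ^ (s - (n : ℝ))) ∧
            (∀ n : ℕ, ∀ ξ : ℝ,
              |iteratedDeriv n ψ₂ ξ| ≤ Cn n * (max 1 |ξ|) ^ (s - (n : ℝ))) ∧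
            ∀ x ξ : ℝ,
              deriv (fun ξ' => A x ξ') ξ * deriv (fun x' => h x' ξ) x -
                deriv (fun x' => A x' ξ) x * deriv (fun ξ' => h x ξ') ξ =
              I₁ * |ξ| ^ (2 * s) * (etaCut (ξ / R)) ^ 2 +
                a₁ x * (ψ₁ ξ) ^ 2 + a₂ x * (ψ₂ ξ) ^ 2 := by
  choose K1 hK1p hK1 using
    symbol_bound s (Phi1 s) 1 (Phi1_contDiff s) (Phi1_zero s) (fun y hy => by
      rw [Phi1, etaCut, if_neg (by linarith), if_neg (by linarith)]; ring)
  choose K2 hK2p hK2 using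
    symbol_bound s (Phi2 s) 0 (Phi2_contDiff s) (Phi2_zero s) (fun y hy => by
      have : expNegInvGlue (2 * (2 - y)) = 0 := expNegInvGlue.zero_of_nonpos (by linarith)
      rw [Phi2, this]; ring)
  refine ⟨85 * (8 * s - 4) + 32 + 680, by linarith, fun n => K1 n + K2 n,
    fun n => add_pos (hK1p n) (hK2p n), ?_⟩
  intro R hR z₁ zm1 atil v J₁ I₁ A h hat hv hJ hI hA hh
  have hR0 : 0 < R := by linarith
  set w : ℂ := z₁ * (starRingEnd ℂ) zm1 with hw
  set ρ : ℝ := ‖z₁‖ * ‖zm1‖ with hρ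
  have hρ0 : 0 ≤ ρ := by positivity
  have hρJ : ρ ≤ J₁ := by rw [hJ]; nlinarith [sq_nonneg (‖z₁‖ - ‖zm1‖)]
  have hJ0 : 0 ≤ J₁ := hρ0.trans hρJ
  have hwn : ‖w‖ = ρ := by rw [hw, norm_mul, RCLike.norm_conj]
  have hnE : ∀ x : ℝ, ‖w * Complex.exp (2 * Complex.I * (x : ℂ))‖ = ρ := by
    intro x
    rw [norm_mul, hwn, show 2 * Complex.I * (x : ℂ) = ((2 * x : ℝ) : ℂ) * Complex.I by
      push_cast; ring, Complex.norm_exp_ofReal_mul_I, mul_one]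
  have hab : ∀ x, |atil x| ≤ ρ := by
    intro x
    rw [hat x, abs_neg, ← hnE x]; exact Complex.abs_im_le_norm _
  have hvb : ∀ x, |v x| ≤ 2 * ρ := by
    intro x
    rw [hv x, abs_mul, ← hnE x, abs_two]
    exact mul_le_mul_of_nonneg_left (Complex.abs_re_le_norm _) (by norm_num)
  have hsum : ∀ x, 4 * atil x ^ 2 + v x ^ 2 = 4 * ρ ^ 2 := by
    intro x
    rw [hat x, hv x, ← hnE x, Complex.sq_norm, Complex.normSq_apply]; ring
  have hED : ∀ x : ℝ, HasDerivAt (fun x : ℝ => w * Complex.exp (2 * Complex.I * (x : ℂ)))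
      (w * (Complex.exp (2 * Complex.I * (x : ℂ)) * (2 * Complex.I * 1))) x := by
    intro x
    exact (((Complex.ofRealCLM.hasDerivAt (x := x)).const_mul (2 * Complex.I)).cexp).const_mul w
  have hatD : ∀ x, HasDerivAt atil (-v x) x := by
    intro x
    have h1 := (Complex.imCLM.hasFDerivAt.comp_hasDerivAt x (hED x)).neg
    have e : atil = -(Complex.imCLM ∘ fun x : ℝ => w * Complex.exp (2 * Complex.I * (x : ℂ))) := by
      funext x; rw [hat x]; rfl
    rw [e]
    refine h1.congr_deriv ?_
    rw [hv x]
    simp only [Complex.imCLM_apply]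
    rw [show w * (Complex.exp (2 * Complex.I * (x : ℂ)) * (2 * Complex.I * 1)) =
      (2 : ℝ) * (Complex.I * (w * Complex.exp (2 * Complex.I * (x : ℂ)))) by push_cast; ring,
      Complex.im_ofReal_mul, Complex.I_mul_im]
  have hvD : ∀ x, HasDerivAt v (4 * atil x) x := by
    intro x
    have h1 := (Complex.reCLM.hasFDerivAt.comp_hasDerivAt x (hED x)).const_mul 2
    have e : v = fun x => 2 * (Complex.reCLM ∘
        fun x : ℝ => w * Complex.exp (2 * Complex.I * (x : ℂ))) x := by
      funext x; rw [hv x]; rfl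
    rw [e]
    refine h1.congr_deriv ?_
    rw [hat x]
    simp only [Complex.reCLM_apply]
    rw [show w * (Complex.exp (2 * Complex.I * (x : ℂ)) * (2 * Complex.I * 1)) =
      (2 : ℝ) * (Complex.I * (w * Complex.exp (2 * Complex.I * (x : ℂ)))) by push_cast; ring,
      Complex.re_ofReal_mul, Complex.I_mul_re]
    ring
  have hEC : ContDiff ℝ (⊤ : ℕ∞) (fun x : ℝ => w * Complex.exp (2 * Complex.I * (x : ℂ))) :=
    contDiff_const.mul ((contDiff_const.mul Complex.ofRealCLM.contDiff).cexp)
  have hatC : ContDiff ℝ (⊤ : ℕ∞) atil := by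
    rw [show atil = fun x : ℝ => -(w * Complex.exp (2 * Complex.I * (x : ℂ))).im from funext hat]
    exact (Complex.imCLM.contDiff.comp hEC).neg
  have hvC : ContDiff ℝ (⊤ : ℕ∞) v := by
    rw [show v = fun x : ℝ => 2 * (w * Complex.exp (2 * Complex.I * (x : ℂ))).re from funext hv]
    exact contDiff_const.mul (Complex.reCLM.contDiff.comp hEC)
  have hEP : ∀ x : ℝ, Complex.exp (2 * Complex.I * ((x + 2 * Real.pi : ℝ) : ℂ)) =
      Complex.exp (2 * Complex.I * (x : ℂ)) := by
    intro x
    rw [show 2 * Complex.I * ((x + 2 * Real.pi : ℝ) : ℂ) =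
      2 * Complex.I * (x : ℂ) + 2 * Real.pi * Complex.I + 2 * Real.pi * Complex.I by
        push_cast; ring,
      Complex.exp_periodic, Complex.exp_periodic]
  have hatP : ∀ x, atil (x + 2 * Real.pi) = atil x := by
    intro x; rw [hat, hat, hEP]
  have hvP : ∀ x, v (x + 2 * Real.pi) = v x := by
    intro x; rw [hv, hv, hEP]
  have hJ2 : J₁ ^ 2 ≤ ‖z₁‖ ^ 4 + ‖zm1‖ ^ 4 := by
    rw [hJ]; nlinarith [sq_nonneg (‖z₁‖ ^ 2 - ‖zm1‖ ^ 2), sq_nonneg (‖z₁‖ ^ 2 + ‖zm1‖ ^ 2)]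
  have scC : ∀ F : ℝ → ℝ, ContDiff ℝ (⊤ : ℕ∞) F →
      ContDiff ℝ (⊤ : ℕ∞) (fun t => R ^ s * F (R⁻¹ * t)) := fun F hF =>
    contDiff_const.mul (hF.comp (contDiff_const.mul contDiff_id))
  have sc0 : ∀ F : ℝ → ℝ, (∀ y ≤ 1, F y = 0) → ∀ ξ ≤ R, R ^ s * F (R⁻¹ * ξ) = 0 := by
    intro F hF ξ hξ
    rw [hF _ (by rw [inv_mul_eq_div, div_le_one hR0]; exact hξ), mul_zero]
  have hg : ∀ ξ : ℝ, |ξ| ^ (2 * s) * (etaCut (ξ / R)) ^ 2 =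
      (R ^ s * Phi1 s (R⁻¹ * ξ)) ^ 2 := by
    intro ξ
    rcases le_or_gt ξ R with hξ | hξ
    · rw [sc0 _ (Phi1_zero s) ξ hξ, etaCut, if_pos ((div_le_one hR0).2 hξ)]; ring
    · have hξ0 : 0 < ξ := by linarith
      rw [Phi1, abs_of_pos hξ0, ← mul_assoc, ← Real.mul_rpow hR0.le (by positivity),
        mul_inv_cancel_left₀ hR0.ne', mul_pow, inv_mul_eq_div, mul_comm 2 s,
        Real.rpow_mul hξ0.le, Real.rpow_two]
  have hA' : ∀ x ξ, A x ξ = atil x * (R ^ s * Phi1 s (R⁻¹ * ξ)) ^ 2 := by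
    intro x ξ; rw [hA, mul_assoc, hg]
  have hp1 := scC _ (Phi1_contDiff s)
  constructor
  · simp only [hA']
    exact (hatC.comp contDiff_fst).mul ((hp1.comp contDiff_snd).pow 2)
  refine ⟨fun x => (8 * s - 4) * atil x ^ 2 + 1 * (J₁ * (2 * ρ + v x)),
    fun x => 8 * atil x ^ 2 + 0 * (J₁ * (2 * ρ + v x)),
    fun t => R ^ s * Phi1 s (R⁻¹ * t), fun t => R ^ s * Phi2 s (R⁻¹ * t),
    ?_, ?_, ?_, ?_, ?_, ?_, ?_, ?_, hp1, scC _ (Phi2_contDiff s), sc0 _ (Phi1_zero s),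
    sc0 _ (Phi2_zero s), ?_, ?_, ?_⟩
  · fun_prop
  · fun_prop
  · intro x; simp only [hatP, hvP]
  · intro x; simp only [hatP, hvP]
  · intro x
    have := (abs_le.1 (hvb x)).1
    have h1 : 0 ≤ 8 * s - 4 := by linarith
    have h2 : 0 ≤ 2 * ρ + v x := by linarith
    positivity
  · intro x
    simp only [zero_mul, add_zero]; positivity
  · intro x
    refine (coeff_bound atil v hatD hvD ρ J₁ (8 * s - 4) 1 hρ0 hρJ (by linarith) (by norm_num)
      hab hvb x).trans ?_
    refine mul_le_mul ?_ hJ2 (by positivity) (by linarith)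
    linarith
  · intro x
    refine (coeff_bound atil v hatD hvD ρ J₁ 8 0 hρ0 hρJ (by norm_num) (by norm_num)
      hab hvb x).trans ?_
    refine mul_le_mul ?_ hJ2 (by positivity) (by linarith)
    linarith
  · intro n ξ
    refine (scaled_bound s _ (Phi1_contDiff s) n _ R hR (hK1p n) (hK1 n) ξ).trans ?_
    refine mul_le_mul_of_nonneg_right (by linarith [hK2p n]) (by positivity)
  · intro n ξ
    refine (scaled_bound s _ (Phi2_contDiff s) n _ R hR (hK2p n) (hK2 n) ξ).trans ?_
    refine mul_le_mul_of_nonneg_right (by linarith [hK1p n]) (by positivity)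
  · intro x ξ
    have hPD : HasDerivAt (Phi1 s) (deriv (Phi1 s) (R⁻¹ * ξ)) (R⁻¹ * ξ) :=
      ((Phi1_contDiff s).differentiable (by simp)).differentiableAt.hasDerivAt
    have hψD : HasDerivAt (fun t => R ^ s * Phi1 s (R⁻¹ * t))
        (R ^ s * (deriv (Phi1 s) (R⁻¹ * ξ) * (R⁻¹ * 1))) ξ :=
      (hPD.comp ξ ((hasDerivAt_id ξ).const_mul R⁻¹)).const_mul (R ^ s)
    have d1 : deriv (fun ξ' => A x ξ') ξ = atil x * (2 * (R ^ s * Phi1 s (R⁻¹ * ξ)) *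
        (R ^ s * (deriv (Phi1 s) (R⁻¹ * ξ) * R⁻¹))) := by
      simp only [hA']
      refine ((hψD.pow 2).const_mul (atil x)).deriv.trans ?_
      simp
    have d2 : deriv (fun x' => h x' ξ) x = 4 * atil x * ξ := by
      simp only [hh]
      exact (((hvD x).const_add J₁).mul_const ξ).deriv
    have d3 : deriv (fun x' => A x' ξ) x = -v x * (R ^ s * Phi1 s (R⁻¹ * ξ)) ^ 2 := by
      simp only [hA']
      exact ((hatD x).mul_const _).deriv
    have d4 : deriv (fun ξ' => h x ξ') ξ = J₁ + v x := by
      simp only [hh]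
      simp
    have hk := Phi_key s (R⁻¹ * ξ)
    have hI' : I₁ = 2 * ρ * (2 * ρ - J₁) := by rw [hI, hρ]; ring
    rw [d1, d2, d3, d4, mul_assoc I₁, hg, hI']
    have hs' := hsum x
    beta_reduce
    generalize Phi1 s (R⁻¹ * ξ) = p at hk ⊢
    generalize Phi2 s (R⁻¹ * ξ) = q at hk ⊢
    generalize deriv (Phi1 s) (R⁻¹ * ξ) = p' at hk ⊢
    generalize R ^ s = r
    linear_combination (8 * atil x ^ 2 * r ^ 2) * hk + (r ^ 2 * p ^ 2) * hs'

end
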